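/- Let φ be an acyclic Sturmian coloring of a d-regular tree (i.e. G_n contains no cycle for every n). Then: (1) for every class D of n-balls with D ≠ A_n, B_n, S_n, C_n, one has i(D,S_n) = 0; and if A_n ≠ S_n, C_n, then i(A_n,S_n) = i(Ā_n,A_{n+1}); (2) if C_n ≠ S_n, then i_A(S_n,S_n) = i(A_{n+1},A_{n+1}), and if furthermore A_{n+1} ≠ C_{n+1}, then i(C_n,S_n) = i_B(S_{n+1},B_{n+1}); (3) if C_n = S_n with A_{n+1} = S_{n+1} and B_{n+1} ≠ C_{n+1}, then i_A(S_n,S_n) = i_A(A_{n+1},A_{n+1}). Analogous identities hold with the roles of A and B exchanged. -/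

import Mathlib

open scoped Classical

noncomputable section

namespace Sturm

variable {V α : Type}

/-- `G` is a `d`-regular tree. -/
structure IsRegularTree (G : SimpleGraph V) (d : ℕ) : Prop where
  isTree : G.IsTree
  regular : ∀ v : V, (G.neighborSet v).ncard = d

/-- Color-preserving isomorphism of the `n`-balls centered at `x` and `y`,
sending center to center. -/
def BallEquiv (G : SimpleGraph V) (φ : V → α) (n : ℕ) (x y : V) : Prop :=
  ∃ f : {z : V // G.dist x z ≤ n} ≃ {z : V // G.dist y z ≤ n},
    (∀ u v : {z : V // G.dist x z ≤ n}, G.Adj u.1 v.1 ↔ G.Adj (f u).1 (f v).1) ∧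
    (∀ u : {z : V // G.dist x z ≤ n}, φ (f u).1 = φ u.1) ∧
    ((f ⟨x, by rw [SimpleGraph.dist_self]; exact Nat.zero_le n⟩).1 = y)

/-- The class of the `n`-ball at `x`, viewed as the set of all centers of equivalent balls. -/
def ballClass (G : SimpleGraph V) (φ : V → α) (n : ℕ) (x : V) : Set V :=
  {y | BallEquiv G φ n x y}

/-- The set `B_n(φ)` of classes of `n`-balls occurring in `(T, φ)`. -/
def ballClasses (G : SimpleGraph V) (φ : V → α) (n : ℕ) : Set (Set V) :=
  {C | ∃ x, C = ballClass G φ n x}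

/-- A coloring is Sturmian if its factor complexity is `n + 2`. -/
def IsSturmian (G : SimpleGraph V) (φ : V → α) : Prop :=
  ∀ n, (ballClasses G φ n).ncard = n + 2

/-- `x` is the center of a special `n`-ball. -/
def IsSpecialVert (G : SimpleGraph V) (φ : V → α) (n : ℕ) (x : V) : Prop :=
  ∃ y, BallEquiv G φ n x y ∧ ¬ BallEquiv G φ (n + 1) x y

/-- `S` is a special class of `n`-balls: the restriction of two distinct classes of
`(n+1)`-balls. -/
def IsSpecialClass (G : SimpleGraph V) (φ : V → α) (n : ℕ) (S : Set V) : Prop :=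
  ∃ x, S = ballClass G φ n x ∧ IsSpecialVert G φ n x

/-- The class `D` is always adjacent to the class `E`. -/
def AlwaysAdjTo (G : SimpleGraph V) (D E : Set V) : Prop :=
  ∀ x ∈ D, ∃ y, G.Adj x y ∧ y ∈ E

/-- The classes `D` and `E` are (always) adjacent. -/
def AlwaysAdj (G : SimpleGraph V) (D E : Set V) : Prop :=
  AlwaysAdjTo G D E ∧ AlwaysAdjTo G E D

/-- The classes `D` and `E` can be adjacent. -/
def CanAdj (G : SimpleGraph V) (D E : Set V) : Prop :=
  ∃ x ∈ D, ∃ y ∈ E, G.Adj x y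

/-- The number of neighbors of `x` lying in (i.e. being centers of balls of class) `E`. -/
def nbrCount (G : SimpleGraph V) (x : V) (E : Set V) : ℕ :=
  (G.neighborSet x ∩ E).ncard

/-- The data of the labels `S_n, C_n, A_n, B_n` for a Sturmian coloring, normalized as in
the paper: `S_0 = A_0 = [a]`, `B_0 = [b]`, `A_{n+1}` (resp. `B_{n+1}`) is always adjacent
to `A_n` (resp. `B_n`), and `A_{n+1}, B_{n+1}` are the two distinct extensions of `S_n`. -/
structure Labeling (G : SimpleGraph V) (φ : V → α) (a b : α) where
  S : ℕ → Set V
  C : ℕ → Set V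
  A : ℕ → Set V
  B : ℕ → Set V
  S_special : ∀ n, IsSpecialClass G φ n (S n)
  C_central : ∀ n, ∃ x, IsSpecialVert G φ (n + 1) x ∧ S (n + 1) = ballClass G φ (n + 1) x ∧
      C n = ballClass G φ n x
  A0_eq_S0 : A 0 = S 0
  A0_col : ∃ x, φ x = a ∧ A 0 = ballClass G φ 0 x
  B0_col : ∃ x, φ x = b ∧ B 0 = ballClass G φ 0 x
  A_ext : ∀ n, ∃ x, IsSpecialVert G φ n x ∧ S n = ballClass G φ n x ∧
      A (n + 1) = ballClass G φ (n + 1) x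
  B_ext : ∀ n, ∃ x, IsSpecialVert G φ n x ∧ S n = ballClass G φ n x ∧
      B (n + 1) = ballClass G φ (n + 1) x
  AB_ne : ∀ n, A (n + 1) ≠ B (n + 1)
  A_adj : ∀ n, AlwaysAdjTo G (A (n + 1)) (A n)
  B_adj : ∀ n, AlwaysAdjTo G (B (n + 1)) (B n)

/-- A cycle (of length `≥ 3`, with pairwise distinct vertices) in the graph `G_n` of
classes of `n`-balls, where classes are joined when they can be adjacent. -/
def IsCycleIn (G : SimpleGraph V) (φ : V → α) (n k : ℕ) (c : ℕ → Set V) : Prop :=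
  3 ≤ k ∧ (∀ i < k, c i ∈ ballClasses G φ n) ∧
    (∀ i < k, CanAdj G (c i) (c ((i + 1) % k))) ∧
    (∀ i < k, ∀ j < k, c i = c j → i = j)

/-- The graph `G_n` contains a cycle. -/
def HasCycle (G : SimpleGraph V) (φ : V → α) (n : ℕ) : Prop :=
  ∃ k c, IsCycleIn G φ n k c

/-! ## Edge-indexed colored graphs -/

/-- An edge-indexed graph, with vertices colored by `α` and labeled by classes
(sets of vertices of the underlying tree `V`). Index `0` means "no edge". -/
structure EIG (V α : Type) where
  Vert : Type
  idx : Vert → Vert → ℕ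
  col : Vert → α
  lab : Vert → Set V

/-- Isomorphism of colored edge-indexed graphs. -/
structure EIGIso (X Y : EIG V α) where
  e : X.Vert ≃ Y.Vert
  idx_eq : ∀ u v, Y.idx (e u) (e v) = X.idx u v
  col_eq : ∀ u, Y.col (e u) = X.col u

/-- The index `i_A(D, E)` (resp. `i_B`, `i`) at the level of classes: the number of
neighbors, in class `E`, of a representative center of `D`; when `D` is the special
class `Sp`, the representative is taken with extension of class `Ext`. -/
def classIdx (G : SimpleGraph V) (Sp Ext : Set V) (D E : Set V) : ℕ :=
  if D = Sp then (if h : Ext.Nonempty then nbrCount G h.some E else 0)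
  else (if h : D.Nonempty then nbrCount G h.some E else 0)

/-- The classes of `n`-balls joined to `Sp` by a path of edges of positive `J`-index. -/
def reachSet (G : SimpleGraph V) (φ : V → α) (n : ℕ) (Sp : Set V)
    (J : Set V → Set V → ℕ) : Set (Set V) :=
  {D | ∃ k, ∃ c : ℕ → Set V, c 0 = Sp ∧ c k = D ∧ (∀ i ≤ k, c i ∈ ballClasses G φ n) ∧
    ∀ i < k, 0 < J (c i) (c (i + 1)) ∨ 0 < J (c (i + 1)) (c i)}

/-- Color of a class: the color of (the center of) any of its representatives. -/
def colOf [Nonempty V] (φ : V → α) (D : Set V) : α :=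
  if h : D.Nonempty then φ h.some else φ (Classical.arbitrary V)

/-- The edge-indexed graph `G^A_n` (when `Ext = A_{n+1}`) resp. `G^B_n`. -/
def sideEIG [Nonempty V] (G : SimpleGraph V) (φ : V → α) (n : ℕ) (Sp Ext : Set V) :
    EIG V α where
  Vert := {D : Set V // D ∈ reachSet G φ n Sp (classIdx G Sp Ext)}
  idx := fun D E => classIdx G Sp Ext D.1 E.1
  col := fun D => colOf φ D.1
  lab := fun D => D.1

variable {G : SimpleGraph V} {φ : V → α} {a b : α}

/-- The edge-indexed graph `G^A_n`. -/
def GAeig [Nonempty V] (L : Labeling G φ a b) (n : ℕ) : EIG V α :=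
  sideEIG G φ n (L.S n) (L.A (n + 1))

/-- The edge-indexed graph `G^B_n`. -/
def GBeig [Nonempty V] (L : Labeling G φ a b) (n : ℕ) : EIG V α :=
  sideEIG G φ n (L.S n) (L.B (n + 1))

/-- Vertex set of `G^A_n`. -/
def VGAset (L : Labeling G φ a b) (n : ℕ) : Set (Set V) :=
  reachSet G φ n (L.S n) (classIdx G (L.S n) (L.A (n + 1)))

/-- Vertex set of `G^B_n`. -/
def VGBset (L : Labeling G φ a b) (n : ℕ) : Set (Set V) :=
  reachSet G φ n (L.S n) (classIdx G (L.S n) (L.B (n + 1)))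

/-- `G^A_n` or `G^B_n`, selected by a letter (`true = A`, `false = B`). -/
def GsideEIG [Nonempty V] (L : Labeling G φ a b) (n : ℕ) : Bool → EIG V α
  | true => GAeig L n
  | false => GBeig L n

/-- Vertex set of `G^A_n` or `G^B_n`, selected by a letter. -/
def VGside (L : Labeling G φ a b) (n : ℕ) : Bool → Set (Set V)
  | true => VGAset L n
  | false => VGBset L n

/-- A single vertex with a loop of index `d` (the graph `G^A_{-1} = G^B_{-1} = F^._{-1}`). -/
def baseEIG (V : Type) (x : α) (d : ℕ) : EIG V α where
  Vert := PUnit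
  idx := fun _ _ => d
  col := fun _ => x
  lab := fun _ => Set.univ

/-- `GAx L d (n+1) = G^A_n`, and `GAx L d 0 = G^A_{-1}`. -/
def GAx [Nonempty V] (L : Labeling G φ a b) (d : ℕ) : ℕ → EIG V α
  | 0 => baseEIG V a d
  | n + 1 => GAeig L n

/-- `GBx L d (n+1) = G^B_n`, and `GBx L d 0 = G^B_{-1}`. -/
def GBx [Nonempty V] (L : Labeling G φ a b) (d : ℕ) : ℕ → EIG V α
  | 0 => baseEIG V b d
  | n + 1 => GBeig L n

/-- `Cx L (n+1) = C_n`, and `Cx L 0 = C_{-1}` (the class of the empty ball). -/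
def Cx (L : Labeling G φ a b) : ℕ → Set V
  | 0 => Set.univ
  | n + 1 => L.C n

/-! ## Concatenations -/

/-- The `(i)`-concatenation of two edge-indexed graphs at the end vertices `v, v'`
(which are identified). -/
def concatI (X Y : EIG V α) (v : X.Vert) (v' : Y.Vert) (i : ℕ) : EIG V α where
  Vert := X.Vert ⊕ {w : Y.Vert // w ≠ v'}
  idx := fun p q =>
    match p, q with
    | Sum.inl u, Sum.inl w =>
        if u = v ∧ w ≠ v then (if X.idx u w = 0 then 0 else i) else X.idx u w
    | Sum.inl u, Sum.inr w => if u = v then Y.idx v' w.1 - i else 0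
    | Sum.inr w, Sum.inl u => if u = v then Y.idx w.1 v' else 0
    | Sum.inr w, Sum.inr w2 => Y.idx w.1 w2.1
  col := Sum.elim X.col (fun w => Y.col w.1)
  lab := Sum.elim X.lab (fun w => Y.lab w.1)

/-- The `(i,j)`-concatenation of two edge-indexed graphs at the end vertices `v, v'`
(which stay distinct, joined by a new edge of indices `i`, `j`). -/
def concatIJ (X Y : EIG V α) (v : X.Vert) (v' : Y.Vert) (i j : ℕ) : EIG V α where
  Vert := X.Vert ⊕ Y.Vert
  idx := fun p q =>
    match p, q with
    | Sum.inl u, Sum.inl w => if u = v ∧ w = v then X.idx v v - i else X.idx u w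
    | Sum.inl u, Sum.inr w => if u = v ∧ w = v' then i else 0
    | Sum.inr w, Sum.inl u => if w = v' ∧ u = v then j else 0
    | Sum.inr u, Sum.inr w => if u = v' ∧ w = v' then Y.idx v' v' - j else Y.idx u w
  col := Sum.elim X.col Y.col
  lab := Sum.elim X.lab Y.lab

/-- `Z` is a concatenation ((i)- or (i,j)-) of `X` and `Y` at `(vX, vY)`. -/
def IsConcatOfAt (Z X Y : EIG V α) (vX : X.Vert) (vY : Y.Vert) : Prop :=
  (∃ i, 1 ≤ i ∧ Nonempty (EIGIso Z (concatI X Y vX vY i))) ∨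
  (∃ i j, 1 ≤ i ∧ 1 ≤ j ∧ Nonempty (EIGIso Z (concatIJ X Y vX vY i j)))

/-! ## Paths, distance, degree in edge-indexed graphs -/

/-- Adjacency (by an edge of positive index, in one of the two orientations). -/
def EIGAdj (X : EIG V α) (u w : X.Vert) : Prop :=
  u ≠ w ∧ (0 < X.idx u w ∨ 0 < X.idx w u)

/-- There is a path of length `L` from `u` to `w`. -/
def EIGReach (X : EIG V α) (u w : X.Vert) (L : ℕ) : Prop :=
  ∃ c : ℕ → X.Vert, c 0 = u ∧ c L = w ∧ ∀ i < L, EIGAdj X (c i) (c (i + 1))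

/-- Graph distance in an edge-indexed graph. -/
def EIGDist (X : EIG V α) (u w : X.Vert) : ℕ :=
  sInf {L | EIGReach X u w L}

/-- `u` has degree one: there is exactly one vertex adjacent to it. -/
def EIGEndVert (X : EIG V α) (u : X.Vert) : Prop :=
  ∃! w, EIGAdj X u w

/-! ## Coverings, direct limits, quotient graph, bounded type -/

/-- `p` exhibits the graph `H` as the universal cover of the edge-indexed graph `Y`:
above a vertex mapping to `u`, the number of neighbors above `w` is the index `idx u w`. -/
def IsEIGCover {W : Type} (H : SimpleGraph W) (Y : EIG V α) (p : W → Y.Vert) : Prop :=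
  ∀ x : W, ∀ u : Y.Vert, (H.neighborSet x ∩ p ⁻¹' {u}).ncard = Y.idx (p x) u

/-- `Y` is the direct limit of the system `F` of colored edge-indexed graphs along the
inclusions `ι`. -/
def IsDirLimit (F : ℕ → EIG V α) (ι : ∀ k, (F k).Vert → (F (k + 1)).Vert)
    (Y : EIG V α) : Prop :=
  ∃ j : ∀ k, (F k).Vert → Y.Vert,
    (∀ k v, j (k + 1) (ι k v) = j k v) ∧
    (∀ k, Function.Injective (j k)) ∧
    (∀ y, ∃ k v, j k v = y) ∧
    (∀ k v, Y.col (j k v) = (F k).col v) ∧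
    (∀ y z : Y.Vert, ∃ N, ∀ k, N ≤ k → ∀ v w, j k v = y → j k w = z →
      Y.idx y z = (F k).idx v w)

/-- The coloring `φ` is of bounded type: every vertex has finite type set. -/
def BoundedType (G : SimpleGraph V) (φ : V → α) : Prop :=
  ∀ v : V, {m : ℕ | IsSpecialVert G φ m v}.Finite

/-- Two vertices are related if some color-preserving automorphism maps one to the other. -/
def colorOrbitRel (G : SimpleGraph V) (φ : V → α) (x y : V) : Prop :=
  ∃ g : V ≃ V, (∀ u w, G.Adj u w ↔ G.Adj (g u) (g w)) ∧ (∀ u, φ (g u) = φ u) ∧ g x = y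

/-- The quotient graph `X_φ = G\T` as a colored edge-indexed graph. -/
def quotEIG (G : SimpleGraph V) (φ : V → α) : EIG V α where
  Vert := Quot (colorOrbitRel G φ)
  idx := fun u w => (G.neighborSet u.out ∩ {z | Quot.mk (colorOrbitRel G φ) z = w}).ncard
  col := fun u => φ u.out
  lab := fun u => {z | Quot.mk (colorOrbitRel G φ) z = u}

/-! ## The sequences `n_k`, `α_k`, `β_k` -/

/-- At level `n`, one of `A_n, B_n` is `S_n` or `C_n`. -/
def SpecTouch (L : Labeling G φ a b) (n : ℕ) : Prop :=
  L.A n = L.S n ∨ L.A n = L.C n ∨ L.B n = L.S n ∨ L.B n = L.C n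

/-- `nk` is the increasing enumeration of the levels where `SpecTouch` holds. -/
def IsNkSeq (L : Labeling G φ a b) (nk : ℕ → ℕ) : Prop :=
  StrictMono nk ∧ ∀ n, (∃ k, nk k = n) ↔ SpecTouch L n

/-- `αs` is the sequence `α_k`: `α_K = A`, and for `k ≠ K`, `α_k` is the side whose
graph `G^{α_k}_{n_k}` has more vertices. -/
def IsAlphaSeq (L : Labeling G φ a b) (nk : ℕ → ℕ) (K : ℕ∞) (αs : ℕ → Bool) : Prop :=
  ∀ k : ℕ, ((k : ℕ∞) = K → αs k = true) ∧
    ((k : ℕ∞) ≠ K → (αs k = true ↔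
      (VGside L (nk k) false).ncard < (VGside L (nk k) true).ncard))

/-- The sequence `β_k(t)`: `β_{k-1}(t)` is the letter `ᾱ_k` if the class of the
`n_k`-ball at `t` is a vertex of `G^{ᾱ_k}_{n_k}`, and `α_k` otherwise. -/
def betaOf (L : Labeling G φ a b) (nk : ℕ → ℕ) (αs : ℕ → Bool) (t : V) (k : ℕ) : Bool :=
  if ballClass G φ (nk (k + 1)) t ∈ VGside L (nk (k + 1)) (!(αs (k + 1))) then
    !(αs (k + 1))
  else αs (k + 1)

end Sturm

namespace Sturm

/-- The identities of Lemma 3.2 for the labels `(S, C, A, B)` of an acyclic Sturmian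
coloring; the indices are expressed via arbitrary representative centers. -/
def AcyclicIndexIdentities (G : SimpleGraph V) (φ : V → α) (S C A B : ℕ → Set V) : Prop :=
  ∀ n : ℕ,
    -- (1): `i(D, S_n) = 0` for `D ≠ A_n, B_n, S_n, C_n`; and if `A_n ≠ S_n, C_n` then
    -- `i(A_n, S_n) = i(Ā_n, A_{n+1})`
    ((∀ D ∈ ballClasses G φ n, D ≠ A n → D ≠ B n → D ≠ S n → D ≠ C n →
        ∀ x ∈ D, nbrCount G x (S n) = 0) ∧
     (A n ≠ S n → A n ≠ C n → ∀ x ∈ A n, ∀ x' ∈ A n,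
        nbrCount G x (S n) = nbrCount G x' (A (n + 1)))) ∧
    -- (2): if `C_n ≠ S_n` then `i_A(S_n, S_n) = i(A_{n+1}, A_{n+1})`; and if moreover
    -- `A_{n+1} ≠ C_{n+1}` then `i(C_n, S_n) = i_B(S_{n+1}, B_{n+1})`
    ((C n ≠ S n →
        (∀ x ∈ A (n + 1), ∀ x' ∈ A (n + 1),
          nbrCount G x (S n) = nbrCount G x' (A (n + 1))) ∧
        (A (n + 1) ≠ C (n + 1) →
          ∀ z ∈ C n, ∀ w ∈ B (n + 2),
            nbrCount G z (S n) = nbrCount G w (B (n + 1))))) ∧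
    -- (3): if `C_n = S_n`, `A_{n+1} = S_{n+1}` and `B_{n+1} ≠ C_{n+1}` then
    -- `i_A(S_n, S_n) = i_A(A_{n+1}, A_{n+1})`
    (C n = S n → A (n + 1) = S (n + 1) → B (n + 1) ≠ C (n + 1) →
      ∀ x ∈ A (n + 1), ∀ w ∈ A (n + 2),
        nbrCount G x (S n) = nbrCount G w (A (n + 1)))

section BallEquivalence

variable {V α : Type} {G : SimpleGraph V} {φ : V → α}

lemma exists_adj_dist_le (hG : G.Connected) {u z : V} {k : ℕ} (h : G.dist u z = k + 1) :
    ∃ w, G.Adj w z ∧ G.dist u w ≤ k := by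
  obtain ⟨p, hp⟩ := hG.exists_walk_length_eq_dist z u
  rw [SimpleGraph.dist_comm, h] at hp
  cases p with
  | nil => simp at hp
  | cons hadj q =>
    refine ⟨_, hadj.symm, ?_⟩
    rw [SimpleGraph.dist_comm]
    refine (SimpleGraph.dist_le q).trans ?_
    simpa using hp.le

lemma dist_le_of_ball_map (hG : G.Connected) {n : ℕ} {x y : V}
    (f : {z : V // G.dist x z ≤ n} → {z : V // G.dist y z ≤ n})
    (hf : ∀ u v : {z : V // G.dist x z ≤ n}, G.Adj u.1 v.1 → G.Adj (f u).1 (f v).1)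
    (u : {z : V // G.dist x z ≤ n}) (k : ℕ) (hk : G.dist x u.1 + k ≤ n)
    (z : {z : V // G.dist x z ≤ n}) (hz : G.dist u.1 z.1 ≤ k) :
    G.dist (f u).1 (f z).1 ≤ k := by
  induction k generalizing z with
  | zero =>
    have : u = z := Subtype.ext (hG.dist_eq_zero_iff.1 (Nat.le_zero.1 hz))
    simp [this]
  | succ k ih =>
    rcases hz.lt_or_eq with h | h
    · exact (ih (by omega) z (by omega)).trans k.le_succ
    · obtain ⟨w, hwz, hw⟩ := exists_adj_dist_le hG h
      have hxw : G.dist x w ≤ n :=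
        (hG.dist_triangle (v := u.1)).trans (by omega)
      have h1 := ih (by omega) ⟨w, hxw⟩ hw
      have h2 := SimpleGraph.dist_eq_one_iff_adj.2 (hf ⟨w, hxw⟩ z hwz)
      have h3 := hG.dist_triangle (u := (f u).1) (v := (f ⟨w, hxw⟩).1) (w := (f z).1)
      omega

lemma BallEquiv.refl (n : ℕ) (x : V) : BallEquiv G φ n x x :=
  ⟨Equiv.refl _, fun _ _ => Iff.rfl, fun _ => rfl, rfl⟩

lemma BallEquiv.symm {n : ℕ} {x y : V} (h : BallEquiv G φ n x y) : BallEquiv G φ n y x := by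
  obtain ⟨f, hadj, hcol, hc⟩ := h
  refine ⟨f.symm, fun u v => ?_, fun u => ?_, ?_⟩
  · rw [hadj, f.apply_symm_apply, f.apply_symm_apply]
  · rw [← hcol, f.apply_symm_apply]
  · rw [← Subtype.ext hc (a2 := ⟨y, by simp⟩), f.symm_apply_apply]

lemma BallEquiv.trans {n : ℕ} {x y z : V} (h : BallEquiv G φ n x y)
    (h' : BallEquiv G φ n y z) : BallEquiv G φ n x z := by
  obtain ⟨f, hadj, hcol, hc⟩ := h
  obtain ⟨g, hadj', hcol', hc'⟩ := h'
  refine ⟨f.trans g, fun u v => (hadj u v).trans (hadj' _ _),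
    fun u => (hcol' _).trans (hcol u), ?_⟩
  rw [Equiv.trans_apply, Subtype.ext hc (a2 := ⟨y, by simp⟩), hc']

lemma BallEquiv.color_eq {n : ℕ} {x y : V} (h : BallEquiv G φ n x y) : φ y = φ x := by
  obtain ⟨f, -, hcol, hc⟩ := h
  simpa [hc] using hcol ⟨x, by simp⟩

/-- An isomorphism of balls restricts to isomorphisms of the smaller balls they contain. -/
lemma ballEquiv_restrict (hG : G.Connected) {n : ℕ} {x y : V}
    (f : {z : V // G.dist x z ≤ n} ≃ {z : V // G.dist y z ≤ n})
    (hadj : ∀ u v : {z : V // G.dist x z ≤ n}, G.Adj u.1 v.1 ↔ G.Adj (f u).1 (f v).1)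
    (hcol : ∀ u : {z : V // G.dist x z ≤ n}, φ (f u).1 = φ u.1)
    (hc : (f ⟨x, by rw [SimpleGraph.dist_self]; exact Nat.zero_le n⟩).1 = y)
    (u : {z : V // G.dist x z ≤ n}) (k : ℕ) (hk : G.dist x u.1 + k ≤ n) :
    BallEquiv G φ k u.1 (f u).1 := by
  have hu : G.dist y (f u).1 ≤ G.dist x u.1 := by
    have := dist_le_of_ball_map hG f (fun u v => (hadj u v).1) ⟨x, by simp⟩ (G.dist x u.1)
      (by simpa using u.2) u le_rfl
    rwa [hc] at this
  have hsymm : ∀ v w, G.Adj v.1 w.1 → G.Adj (f.symm v).1 (f.symm w).1 := fun v w h => by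
    rw [hadj]; simpa using h
  have hball : ∀ z, G.dist u.1 z ≤ k → G.dist x z ≤ n := fun z hz =>
    (hG.dist_triangle (v := u.1)).trans (by omega)
  have hball' : ∀ z, G.dist (f u).1 z ≤ k → G.dist y z ≤ n := fun z hz =>
    (hG.dist_triangle (v := (f u).1)).trans (by omega)
  refine ⟨⟨fun z => ⟨(f ⟨z.1, hball z.1 z.2⟩).1, ?_⟩,
    fun z => ⟨(f.symm ⟨z.1, hball' z.1 z.2⟩).1, ?_⟩, fun z => ?_, fun z => ?_⟩,
    fun v w => hadj ⟨v.1, hball v.1 v.2⟩ ⟨w.1, hball w.1 w.2⟩, fun v => hcol _, rfl⟩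
  · exact dist_le_of_ball_map hG f (fun u v => (hadj u v).1) u k hk _ z.2
  · simpa using dist_le_of_ball_map hG f.symm hsymm (f u) k (by omega) ⟨z.1, hball' z.1 z.2⟩ z.2
  · simp
  · simp

lemma BallEquiv.of_succ (hG : G.Connected) {n : ℕ} {x y : V}
    (h : BallEquiv G φ (n + 1) x y) : BallEquiv G φ n x y := by
  obtain ⟨f, hadj, hcol, hc⟩ := h
  have := ballEquiv_restrict hG f hadj hcol hc ⟨x, by simp⟩ n (by simp)
  rwa [hc] at this

/-- Equivalent `(n+1)`-balls have neighbors matched by equivalence of `n`-balls. -/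
lemma BallEquiv.exists_neighbor_equiv (hG : G.Connected) {n : ℕ} {x y : V}
    (h : BallEquiv G φ (n + 1) x y) :
    ∃ e : G.neighborSet x ≃ G.neighborSet y, ∀ u, BallEquiv G φ n u.1 (e u).1 := by
  obtain ⟨f, hadj, hcol, hc⟩ := h
  have hx : ∀ z, G.Adj x z → G.dist x z = 1 := fun z => SimpleGraph.dist_eq_one_iff_adj.2
  have hy : ∀ z, G.Adj y z → G.dist y z = 1 := fun z => SimpleGraph.dist_eq_one_iff_adj.2
  have hbx : ∀ z, G.Adj x z → G.dist x z ≤ n + 1 := fun z hz => by have := hx z hz; omega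
  have hby : ∀ z, G.Adj y z → G.dist y z ≤ n + 1 := fun z hz => by have := hy z hz; omega
  refine ⟨⟨fun z => ⟨(f ⟨z.1, hbx _ z.2⟩).1, ?_⟩, fun z => ⟨(f.symm ⟨z.1, hby _ z.2⟩).1, ?_⟩,
    fun z => ?_, fun z => ?_⟩, fun u => ?_⟩
  · have := (hadj ⟨x, by simp⟩ ⟨z.1, hbx _ z.2⟩).1 z.2
    rwa [hc] at this
  · have := (hadj ⟨x, by simp⟩ (f.symm ⟨z.1, hby _ z.2⟩))
    rw [hc, f.apply_symm_apply] at this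
    exact this.2 z.2
  · simp
  · simp
  · exact ballEquiv_restrict hG f hadj hcol hc ⟨u.1, hbx _ u.2⟩ n (by rw [hx _ u.2, add_comm])

lemma mem_ballClass_self (n : ℕ) (x : V) : x ∈ ballClass G φ n x := BallEquiv.refl n x

lemma ballClass_eq_iff {n : ℕ} {x y : V} :
    ballClass G φ n x = ballClass G φ n y ↔ BallEquiv G φ n x y := by
  refine ⟨fun h => ?_, fun h => Set.ext fun z => ⟨h.symm.trans, h.trans⟩⟩
  have : y ∈ ballClass G φ n x := h ▸ mem_ballClass_self n y
  exact this

lemma eq_ballClass_of_mem {n : ℕ} {D : Set V} (hD : D ∈ ballClasses G φ n) {x : V}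
    (hx : x ∈ D) : D = ballClass G φ n x := by
  obtain ⟨y, rfl⟩ := hD
  exact ballClass_eq_iff.2 hx

lemma ballEquiv_of_mem {n : ℕ} {D : Set V} (hD : D ∈ ballClasses G φ n) {x y : V}
    (hx : x ∈ D) (hy : y ∈ D) : BallEquiv G φ n x y := by
  rwa [eq_ballClass_of_mem hD hx] at hy

lemma mem_of_ballEquiv {n : ℕ} {D : Set V} (hD : D ∈ ballClasses G φ n) {x y : V}
    (hx : x ∈ D) (h : BallEquiv G φ n x y) : y ∈ D := by
  rwa [eq_ballClass_of_mem hD hx]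

lemma ballClasses_eq_of_mem {n : ℕ} {D E : Set V} (hD : D ∈ ballClasses G φ n)
    (hE : E ∈ ballClasses G φ n) {x : V} (hxD : x ∈ D) (hxE : x ∈ E) : D = E :=
  (eq_ballClass_of_mem hD hxD).trans (eq_ballClass_of_mem hE hxE).symm

lemma nonempty_of_mem_ballClasses {n : ℕ} {D : Set V} (hD : D ∈ ballClasses G φ n) :
    D.Nonempty := by
  obtain ⟨x, rfl⟩ := hD
  exact ⟨x, mem_ballClass_self n x⟩

lemma ballClass_succ_subset (hG : G.Connected) (n : ℕ) (x : V) :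
    ballClass G φ (n + 1) x ⊆ ballClass G φ n x := fun _ h => BallEquiv.of_succ hG h

/-- The number of neighbors in a class of `n`-balls is determined by the `(n+1)`-ball. -/
lemma nbrCount_eq_of_ballEquiv (hG : G.Connected) {n : ℕ} {x y : V}
    (h : BallEquiv G φ (n + 1) x y) {E : Set V} (hE : E ∈ ballClasses G φ n) :
    nbrCount G x E = nbrCount G y E := by
  obtain ⟨e, he⟩ := h.exists_neighbor_equiv hG
  refine Set.ncard_congr (fun u hu => (e ⟨u, hu.1⟩).1) ?_ ?_ ?_
  · exact fun u hu => ⟨(e ⟨u, hu.1⟩).2, mem_of_ballEquiv hE hu.2 (he ⟨u, hu.1⟩)⟩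
  · intro u v hu hv huv
    simpa using e.injective (Subtype.ext huv)
  · intro v hv
    refine ⟨(e.symm ⟨v, hv.1⟩).1, ⟨(e.symm ⟨v, hv.1⟩).2, ?_⟩, by simp⟩
    have := he (e.symm ⟨v, hv.1⟩)
    rw [e.apply_symm_apply] at this
    exact mem_of_ballEquiv hE hv.2 this.symm

lemma CanAdj.symm {D E : Set V} (h : CanAdj G D E) : CanAdj G E D := by
  obtain ⟨x, hx, y, hy, hxy⟩ := h
  exact ⟨y, hy, x, hx, hxy.symm⟩

lemma hasCycle_of_triangle {n : ℕ} {D E F : Set V} (hD : D ∈ ballClasses G φ n)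
    (hE : E ∈ ballClasses G φ n) (hF : F ∈ ballClasses G φ n) (hDE : CanAdj G D E)
    (hEF : CanAdj G E F) (hFD : CanAdj G F D) (h1 : D ≠ E) (h2 : E ≠ F) (h3 : F ≠ D) :
    HasCycle G φ n := by
  refine ⟨3, fun i => if i = 0 then D else if i = 1 then E else F, le_rfl, ?_, ?_, ?_⟩
  · intro i hi
    interval_cases i <;> simpa
  · intro i hi
    interval_cases i <;> simpa
  · intro i hi j hj
    interval_cases i <;> interval_cases j <;> simp [h1, h2, h3, h1.symm, h2.symm, h3.symm]

lemma hasCycle_of_square {n : ℕ} {D E F H : Set V} (hD : D ∈ ballClasses G φ n)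
    (hE : E ∈ ballClasses G φ n) (hF : F ∈ ballClasses G φ n) (hH : H ∈ ballClasses G φ n)
    (hDE : CanAdj G D E) (hEF : CanAdj G E F) (hFH : CanAdj G F H) (hHD : CanAdj G H D)
    (h1 : D ≠ E) (h2 : E ≠ F) (h3 : F ≠ H) (h4 : H ≠ D) (h5 : D ≠ F) (h6 : E ≠ H) :
    HasCycle G φ n := by
  refine ⟨4, fun i => if i = 0 then D else if i = 1 then E else if i = 2 then F else H,
    by norm_num, ?_, ?_, ?_⟩
  · intro i hi
    interval_cases i <;> simpa
  · intro i hi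
    interval_cases i <;> simpa
  · intro i hi j hj
    interval_cases i <;> interval_cases j <;>
      simp [h1, h2, h3, h4, h5, h6, h1.symm, h2.symm, h3.symm, h4.symm, h5.symm, h6.symm]

end BallEquivalence

/-- The properties of the labels `S, C, A, B` that are symmetric in `A` and `B`. -/
structure SymmLabels {V α : Type} (G : SimpleGraph V) (φ : V → α) (S C A B : ℕ → Set V) :
    Prop where
  S_mem : ∀ n, S n ∈ ballClasses G φ n
  C_mem : ∀ n, C n ∈ ballClasses G φ n
  A_mem : ∀ n, A n ∈ ballClasses G φ n
  B_mem : ∀ n, B n ∈ ballClasses G φ n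
  A_subset : ∀ n, A (n + 1) ⊆ S n
  B_subset : ∀ n, B (n + 1) ⊆ S n
  S_subset : ∀ n, S (n + 1) ⊆ C n
  A_ne_B : ∀ n, A n ≠ B n
  A_adj : ∀ n, AlwaysAdjTo G (A (n + 1)) (A n)
  B_adj : ∀ n, AlwaysAdjTo G (B (n + 1)) (B n)

section Labels

variable {V α : Type} {G : SimpleGraph V} {φ : V → α}

lemma Labeling.symmLabels {a b : α} (hG : G.Connected) (hab : a ≠ b)
    (L : Labeling G φ a b) : SymmLabels G φ L.S L.C L.A L.B where
  S_mem n := by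
    obtain ⟨x, hx, -⟩ := L.S_special n
    exact ⟨x, hx⟩
  C_mem n := by
    obtain ⟨x, -, -, hx⟩ := L.C_central n
    exact ⟨x, hx⟩
  A_mem n := by
    cases n with
    | zero => obtain ⟨x, -, hx⟩ := L.A0_col; exact ⟨x, hx⟩
    | succ n => obtain ⟨x, -, -, hx⟩ := L.A_ext n; exact ⟨x, hx⟩
  B_mem n := by
    cases n with
    | zero => obtain ⟨x, -, hx⟩ := L.B0_col; exact ⟨x, hx⟩
    | succ n => obtain ⟨x, -, -, hx⟩ := L.B_ext n; exact ⟨x, hx⟩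
  A_subset n := by
    obtain ⟨x, -, h, h'⟩ := L.A_ext n
    rw [h, h']
    exact ballClass_succ_subset hG n x
  B_subset n := by
    obtain ⟨x, -, h, h'⟩ := L.B_ext n
    rw [h, h']
    exact ballClass_succ_subset hG n x
  S_subset n := by
    obtain ⟨x, -, h, h'⟩ := L.C_central n
    rw [h, h']
    exact ballClass_succ_subset hG n x
  A_ne_B n := by
    cases n with
    | zero =>
      obtain ⟨x, hx, hA⟩ := L.A0_col
      obtain ⟨y, hy, hB⟩ := L.B0_col
      rw [hA, hB, Ne, ballClass_eq_iff]
      intro h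
      exact hab (by rw [← hx, ← hy, h.color_eq])
    | succ n => exact L.AB_ne n
  A_adj := L.A_adj
  B_adj := L.B_adj

lemma IsSturmian.ballClasses_finite (hSt : IsSturmian G φ) (n : ℕ) :
    (ballClasses G φ n).Finite :=
  Set.finite_of_ncard_ne_zero (by rw [hSt n]; omega)

/-- A choice of one extension of each class of `n`-balls misses only one class of
`(n+1)`-balls. -/
lemma IsSturmian.exists_section (hG : G.Connected) (hSt : IsSturmian G φ) (n : ℕ) :
    ∃ s : Set V → Set V,
      (∀ x y, ¬ BallEquiv G φ (n + 1) x y → BallEquiv G φ n x y →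
        ballClass G φ (n + 1) x ∉ s '' ballClasses G φ n ∨
        ballClass G φ (n + 1) y ∉ s '' ballClasses G φ n) ∧
      ∀ p ∈ ballClasses G φ (n + 1), ∀ q ∈ ballClasses G φ (n + 1),
        p ∉ s '' ballClasses G φ n → q ∉ s '' ballClasses G φ n → p = q := by
  let s : Set V → Set V := fun D => if h : D.Nonempty then ballClass G φ (n + 1) h.some else ∅
  have hs : ∀ D ∈ ballClasses G φ n, ∃ x ∈ D, s D = ballClass G φ (n + 1) x := fun D hD =>
    ⟨_, (nonempty_of_mem_ballClasses hD).some_mem, dif_pos (nonempty_of_mem_ballClasses hD)⟩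
  have hsub : ∀ D ∈ ballClasses G φ n, ∀ z, s D = ballClass G φ (n + 1) z → z ∈ D := by
    intro D hD z hz
    obtain ⟨x, hx, hxs⟩ := hs D hD
    exact mem_of_ballEquiv hD hx ((ballClass_eq_iff.1 (hxs.symm.trans hz)).of_succ hG)
  have hinj : Set.InjOn s (ballClasses G φ n) := by
    intro D hD E hE hDE
    obtain ⟨x, hx, hxs⟩ := hs D hD
    exact ballClasses_eq_of_mem hD hE hx (hsub E hE x (hDE ▸ hxs))
  refine ⟨s, fun x y hxy hxy' => ?_, fun p hp q hq hps hqs => ?_⟩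
  · by_contra! h
    obtain ⟨⟨D, hD, hDx⟩, E, hE, hEy⟩ := h
    have hDE : D = E := ballClasses_eq_of_mem hD hE
      (mem_of_ballEquiv hD (hsub D hD x hDx) hxy') (hsub E hE y hEy)
    exact hxy (ballClass_eq_iff.1 (by rw [← hDx, ← hEy, hDE]))
  · have himg : s '' ballClasses G φ n ⊆ ballClasses G φ (n + 1) := by
      rintro _ ⟨D, hD, rfl⟩
      obtain ⟨x, -, hxs⟩ := hs D hD
      exact ⟨x, hxs⟩
    have hcard : (ballClasses G φ (n + 1) \ s '' ballClasses G φ n).ncard ≤ 1 := by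
      rw [Set.ncard_sdiff himg ((hSt.ballClasses_finite n).image s), hinj.ncard_image, hSt, hSt]
      omega
    exact (Set.ncard_le_one ((hSt.ballClasses_finite (n + 1)).sdiff)).1 hcard
      p ⟨hp, hps⟩ q ⟨hq, hqs⟩

namespace SymmLabels

variable {S C A B : ℕ → Set V}

lemma swap (h : SymmLabels G φ S C A B) : SymmLabels G φ S C B A where
  S_mem := h.S_mem
  C_mem := h.C_mem
  A_mem := h.B_mem
  B_mem := h.A_mem
  A_subset := h.B_subset
  B_subset := h.A_subset
  S_subset := h.S_subset
  A_ne_B n := (h.A_ne_B n).symm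
  A_adj := h.B_adj
  B_adj := h.A_adj

lemma exists_mem_A (h : SymmLabels G φ S C A B) (n : ℕ) : ∃ x, x ∈ A n :=
  nonempty_of_mem_ballClasses (h.A_mem n)

lemma exists_mem_B (h : SymmLabels G φ S C A B) (n : ℕ) : ∃ x, x ∈ B n :=
  h.swap.exists_mem_A n

lemma not_ballEquiv (h : SymmLabels G φ S C A B) {n : ℕ} {x y : V} (hx : x ∈ A n)
    (hy : y ∈ B n) : ¬ BallEquiv G φ n x y := fun hxy =>
  h.A_ne_B n (ballClasses_eq_of_mem (h.A_mem n) (h.B_mem n)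
    (mem_of_ballEquiv (h.A_mem n) hx hxy) hy)

/-- A non-special `n`-ball has a unique extension. -/
lemma ballEquiv_succ (h : SymmLabels G φ S C A B) (hG : G.Connected) (hSt : IsSturmian G φ)
    {n : ℕ} {x y : V} (hx : x ∉ S n) (hxy : BallEquiv G φ n x y) :
    BallEquiv G φ (n + 1) x y := by
  by_contra hne
  obtain ⟨s, hs, hs'⟩ := hSt.exists_section hG n
  obtain ⟨u, hu⟩ := h.exists_mem_A (n + 1)
  obtain ⟨v, hv⟩ := h.exists_mem_B (n + 1)
  have key : ∀ z, BallEquiv G φ n x z → ∀ w ∈ S n,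
      ballClass G φ (n + 1) z ∉ s '' ballClasses G φ n →
      ballClass G φ (n + 1) w ∉ s '' ballClasses G φ n → False := by
    intro z hz w hw hzs hws
    have hzw := ballClass_eq_iff.1 (hs' _ ⟨z, rfl⟩ _ ⟨w, rfl⟩ hzs hws)
    exact hx (mem_of_ballEquiv (h.S_mem n) hw (hz.trans (hzw.of_succ hG)).symm)
  have huS := h.A_subset n hu
  have hvS := h.B_subset n hv
  rcases hs x y hne hxy with h1 | h1 <;>
    rcases hs u v (h.not_ballEquiv hu hv) (ballEquiv_of_mem (h.S_mem n) huS hvS) with h2 | h2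
  · exact key x (BallEquiv.refl n x) u huS h1 h2
  · exact key x (BallEquiv.refl n x) v hvS h1 h2
  · exact key y hxy u huS h1 h2
  · exact key y hxy v hvS h1 h2

/-- The special `n`-ball has no extensions other than `A (n + 1)` and `B (n + 1)`. -/
lemma mem_A_or_mem_B (h : SymmLabels G φ S C A B) (hG : G.Connected) (hSt : IsSturmian G φ)
    {n : ℕ} {x : V} (hx : x ∈ S n) : x ∈ A (n + 1) ∨ x ∈ B (n + 1) := by
  by_contra! hne
  obtain ⟨s, hs, hs'⟩ := hSt.exists_section hG n
  obtain ⟨u, hu⟩ := h.exists_mem_A (n + 1)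
  obtain ⟨v, hv⟩ := h.exists_mem_B (n + 1)
  have huS := h.A_subset n hu
  have hvS := h.B_subset n hv
  have hxu : ¬ BallEquiv G φ (n + 1) x u := fun hxu =>
    hne.1 (mem_of_ballEquiv (h.A_mem _) hu hxu.symm)
  have hxv : ¬ BallEquiv G φ (n + 1) x v := fun hxv =>
    hne.2 (mem_of_ballEquiv (h.B_mem _) hv hxv.symm)
  have huv := h.not_ballEquiv hu hv
  have h1 := hs x u hxu (ballEquiv_of_mem (h.S_mem n) hx huS)
  have h2 := hs x v hxv (ballEquiv_of_mem (h.S_mem n) hx hvS)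
  have h3 := hs u v huv (ballEquiv_of_mem (h.S_mem n) huS hvS)
  have key : ∀ z w, ¬ BallEquiv G φ (n + 1) z w →
      ballClass G φ (n + 1) z ∉ s '' ballClasses G φ n →
      ballClass G φ (n + 1) w ∉ s '' ballClasses G φ n → False := fun z w hzw hzs hws =>
    hzw (ballClass_eq_iff.1 (hs' _ ⟨z, rfl⟩ _ ⟨w, rfl⟩ hzs hws))
  have := key x u hxu
  have := key x v hxv
  have := key u v huv
  tauto

/-- A non-special class of `n`-balls is, as a set of centers, a class of `(n+1)`-balls. -/
lemma mem_ballClasses_succ (h : SymmLabels G φ S C A B) (hG : G.Connected)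
    (hSt : IsSturmian G φ) {n : ℕ} {D : Set V} (hD : D ∈ ballClasses G φ n) (hDS : D ≠ S n) :
    D ∈ ballClasses G φ (n + 1) := by
  obtain ⟨x, rfl⟩ := hD
  have hx : x ∉ S n := fun hx => hDS (eq_ballClass_of_mem (h.S_mem n) hx).symm
  exact ⟨x, Set.Subset.antisymm (fun y hy => h.ballEquiv_succ hG hSt hx hy)
    (ballClass_succ_subset hG n x)⟩

/-- A class of `(n+1)`-balls other than `A (n + 1)` and `B (n + 1)` is, as a set of centers,
a class of `n`-balls. -/
lemma mem_ballClasses_of_succ (h : SymmLabels G φ S C A B) (hG : G.Connected)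
    (hSt : IsSturmian G φ) {n : ℕ} {D : Set V} (hD : D ∈ ballClasses G φ (n + 1))
    (hDA : D ≠ A (n + 1)) (hDB : D ≠ B (n + 1)) : D ∈ ballClasses G φ n := by
  obtain ⟨x, rfl⟩ := hD
  have hx : x ∉ S n := fun hx => (h.mem_A_or_mem_B hG hSt hx).elim
    (fun hA => hDA (eq_ballClass_of_mem (h.A_mem _) hA).symm)
    (fun hB => hDB (eq_ballClass_of_mem (h.B_mem _) hB).symm)
  exact ⟨x, Set.Subset.antisymm (ballClass_succ_subset hG n x)
    (fun y hy => h.ballEquiv_succ hG hSt hx hy)⟩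

lemma eq_A_or_eq_B_zero (h : SymmLabels G φ S C A B) (hSt : IsSturmian G φ) {D : Set V}
    (hD : D ∈ ballClasses G φ 0) : D = A 0 ∨ D = B 0 := by
  have hsub : ({A 0, B 0} : Set (Set V)) ⊆ ballClasses G φ 0 := by
    rintro E (rfl | rfl)
    exacts [h.A_mem 0, h.B_mem 0]
  have := Set.eq_of_subset_of_ncard_le hsub
    (by rw [hSt 0, Set.ncard_pair (h.A_ne_B 0)]) (hSt.ballClasses_finite 0)
  rwa [← this] at hD

lemma canAdj_S_A (h : SymmLabels G φ S C A B) (n : ℕ) : CanAdj G (S n) (A n) := by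
  obtain ⟨x, hx⟩ := h.exists_mem_A (n + 1)
  obtain ⟨y, hxy, hy⟩ := h.A_adj n x hx
  exact ⟨x, h.A_subset n hx, y, hy, hxy⟩

lemma canAdj_S_B (h : SymmLabels G φ S C A B) (n : ℕ) : CanAdj G (S n) (B n) :=
  h.swap.canAdj_S_A n

/-- In an acyclic coloring only `A n`, `B n` and `S n` can be adjacent to both `A n` and
`B n`. -/
lemma not_canAdj_both (h : SymmLabels G φ S C A B) {n : ℕ} (hacyc : ¬ HasCycle G φ n)
    {D : Set V} (hD : D ∈ ballClasses G φ n) (hDA : D ≠ A n) (hDB : D ≠ B n) (hDS : D ≠ S n)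
    (hA : CanAdj G D (A n)) (hB : CanAdj G D (B n)) : False := by
  by_cases hSA : S n = A n
  · exact hacyc (hasCycle_of_triangle hD (h.A_mem n) (h.B_mem n) hA (hSA ▸ h.canAdj_S_B n)
      hB.symm hDA (h.A_ne_B n) hDB.symm)
  by_cases hSB : S n = B n
  · exact hacyc (hasCycle_of_triangle hD (h.A_mem n) (h.B_mem n) hA
      (hSB ▸ h.canAdj_S_A n).symm hB.symm hDA (h.A_ne_B n) hDB.symm)
  exact hacyc (hasCycle_of_square hD (h.A_mem n) (h.S_mem n) (h.B_mem n) hA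
    (h.canAdj_S_A n).symm (h.canAdj_S_B n) hB.symm hDA (Ne.symm hSA) hSB hDB.symm hDS
    (h.A_ne_B n))

lemma ne_of_S_subset (h : SymmLabels G φ S C A B) {n : ℕ} {D E : Set V}
    (hD : D ∈ ballClasses G φ n) (hDS : D ≠ S n) (hE : E ⊆ S n) : D ≠ E := by
  rintro rfl
  obtain ⟨x, hx⟩ := nonempty_of_mem_ballClasses hD
  exact hDS (ballClasses_eq_of_mem hD (h.S_mem n) hx (hE hx))

lemma ne_S_succ (h : SymmLabels G φ S C A B) {n : ℕ} {D : Set V}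
    (hD : D ∈ ballClasses G φ n) (hDC : D ≠ C n) : D ≠ S (n + 1) := by
  rintro rfl
  obtain ⟨x, hx⟩ := nonempty_of_mem_ballClasses hD
  exact hDC (ballClasses_eq_of_mem hD (h.C_mem n) hx (h.S_subset n hx))

/-- Neighbors in a class other than `A n` and `B n` do not distinguish the two extensions
of `S n`. -/
lemma canAdj_B_of_canAdj_A (h : SymmLabels G φ S C A B) (hG : G.Connected)
    (hSt : IsSturmian G φ) {n : ℕ} {D : Set V} (hD : D ∈ ballClasses G φ n) (hDA : D ≠ A n)
    (hDB : D ≠ B n) (hA : CanAdj G D (A (n + 1))) : CanAdj G D (B (n + 1)) := by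
  cases n with
  | zero => exact ((h.eq_A_or_eq_B_zero hSt hD).elim hDA hDB).elim
  | succ n =>
    have hD' := h.mem_ballClasses_of_succ hG hSt hD hDA hDB
    obtain ⟨x, hx, y, hy, hxy⟩ := hA
    obtain ⟨v, hv⟩ := h.exists_mem_B (n + 2)
    have hyv := ballEquiv_of_mem (h.S_mem (n + 1)) (h.A_subset _ hy) (h.B_subset _ hv)
    obtain ⟨e, he⟩ := hyv.exists_neighbor_equiv hG
    exact ⟨_, mem_of_ballEquiv hD' hx (he ⟨x, hxy.symm⟩), v, hv, (e ⟨x, hxy.symm⟩).2.symm⟩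

/-- A class other than `A n`, `B n`, `S n`, `C n` is not adjacent to the special class. -/
lemma not_canAdj_S (h : SymmLabels G φ S C A B) (hG : G.Connected) (hSt : IsSturmian G φ)
    (hacyc : ∀ n, ¬ HasCycle G φ n) {n : ℕ} {D : Set V} (hD : D ∈ ballClasses G φ n)
    (hDA : D ≠ A n) (hDB : D ≠ B n) (hDS : D ≠ S n) (hDC : D ≠ C n) :
    ¬ CanAdj G D (S n) := by
  rintro ⟨x, hx, y, hy, hxy⟩
  have hAB : CanAdj G D (A (n + 1)) ∧ CanAdj G D (B (n + 1)) := by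
    rcases h.mem_A_or_mem_B hG hSt hy with hy | hy
    · have hA : CanAdj G D (A (n + 1)) := ⟨x, hx, y, hy, hxy⟩
      exact ⟨hA, h.canAdj_B_of_canAdj_A hG hSt hD hDA hDB hA⟩
    · have hB : CanAdj G D (B (n + 1)) := ⟨x, hx, y, hy, hxy⟩
      exact ⟨h.swap.canAdj_B_of_canAdj_A hG hSt hD hDB hDA hB, hB⟩
  exact h.not_canAdj_both (hacyc (n + 1)) (h.mem_ballClasses_succ hG hSt hD hDS)
    (h.ne_of_S_subset hD hDS (h.A_subset n)) (h.ne_of_S_subset hD hDS (h.B_subset n))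
    (h.ne_S_succ hD hDC) hAB.1 hAB.2

lemma not_canAdj_A_B_succ (h : SymmLabels G φ S C A B) (hG : G.Connected)
    (hSt : IsSturmian G φ) (hacyc : ∀ n, ¬ HasCycle G φ n) {n : ℕ} (hAS : A n ≠ S n)
    (hAC : A n ≠ C n) : ¬ CanAdj G (A n) (B (n + 1)) := by
  intro hB
  obtain ⟨x, hx⟩ := h.exists_mem_A (n + 1)
  obtain ⟨y, hxy, hy⟩ := h.A_adj n x hx
  exact h.not_canAdj_both (hacyc (n + 1)) (h.mem_ballClasses_succ hG hSt (h.A_mem n) hAS)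
    (h.ne_of_S_subset (h.A_mem n) hAS (h.A_subset n))
    (h.ne_of_S_subset (h.A_mem n) hAS (h.B_subset n))
    (h.ne_S_succ (h.A_mem n) hAC) ⟨y, hy, x, hx, hxy.symm⟩ hB

lemma S_succ_ne_of_subset_S (h : SymmLabels G φ S C A B) {n : ℕ} (hCS : C n ≠ S n)
    {D : Set V} (hD : D ⊆ S n) : S (n + 1) ≠ D := by
  rintro rfl
  obtain ⟨x, hx⟩ := nonempty_of_mem_ballClasses (h.S_mem (n + 1))
  exact hCS (ballClasses_eq_of_mem (h.C_mem n) (h.S_mem n) (h.S_subset n hx) (hD hx))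

lemma not_canAdj_A_succ_B_succ (h : SymmLabels G φ S C A B)
    (hacyc : ∀ n, ¬ HasCycle G φ n) {n : ℕ} (hCS : C n ≠ S n) :
    ¬ CanAdj G (A (n + 1)) (B (n + 1)) := fun hAB =>
  hacyc (n + 1) (hasCycle_of_triangle (h.S_mem _) (h.A_mem _) (h.B_mem _) (h.canAdj_S_A _) hAB
    (h.canAdj_S_B _).symm (h.S_succ_ne_of_subset_S hCS (h.A_subset n)) (h.A_ne_B _)
    (h.S_succ_ne_of_subset_S hCS (h.B_subset n)).symm)

/-- If `D` is not adjacent to `B (n + 1)`, its neighbors in `S n` are those in `A (n + 1)`. -/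
lemma nbrCount_S_eq (h : SymmLabels G φ S C A B) (hG : G.Connected) (hSt : IsSturmian G φ)
    {n : ℕ} {D : Set V} (hD : ¬ CanAdj G D (B (n + 1))) {x : V} (hx : x ∈ D) :
    nbrCount G x (S n) = nbrCount G x (A (n + 1)) := by
  unfold nbrCount
  congr 1
  refine Set.Subset.antisymm (fun y hy => ⟨hy.1, ?_⟩)
    (Set.inter_subset_inter_right _ (h.A_subset n))
  exact (h.mem_A_or_mem_B hG hSt hy.2).resolve_right fun hB => hD ⟨x, hx, y, hB, hy.1⟩

lemma nbrCount_S_eq_of_mem (h : SymmLabels G φ S C A B) (hG : G.Connected)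
    {n : ℕ} {D : Set V} (hD : D ∈ ballClasses G φ (n + 1)) {x y : V} (hx : x ∈ D)
    (hy : y ∈ D) : nbrCount G x (S n) = nbrCount G y (S n) :=
  nbrCount_eq_of_ballEquiv hG (ballEquiv_of_mem hD hx hy) (h.S_mem n)

theorem acyclicIndexIdentities (h : SymmLabels G φ S C A B) (hG : G.Connected)
    (hSt : IsSturmian G φ) (hacyc : ∀ n, ¬ HasCycle G φ n) :
    AcyclicIndexIdentities G φ S C A B := by
  refine fun n => ⟨⟨fun D hD hDA hDB hDS hDC x hx => ?_, fun hAS hAC x hx x' hx' => ?_⟩,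
    fun hCS => ⟨fun x hx x' hx' => ?_, fun hAC z hz w hw => ?_⟩, fun _ hAS hBC x hx w hw => ?_⟩
  · have hempty : G.neighborSet x ∩ S n = ∅ := Set.eq_empty_of_forall_notMem fun y hy =>
      h.not_canAdj_S hG hSt hacyc hD hDA hDB hDS hDC ⟨x, hx, y, hy.2, hy.1⟩
    rw [nbrCount, hempty, Set.ncard_empty]
  · rw [h.nbrCount_S_eq_of_mem hG (h.mem_ballClasses_succ hG hSt (h.A_mem n) hAS) hx hx']
    exact h.nbrCount_S_eq hG hSt (h.not_canAdj_A_B_succ hG hSt hacyc hAS hAC) hx'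
  · rw [h.nbrCount_S_eq_of_mem hG (h.A_mem (n + 1)) hx hx']
    exact h.nbrCount_S_eq hG hSt (h.not_canAdj_A_succ_B_succ hacyc hCS) hx'
  · have hAS := (h.S_succ_ne_of_subset_S hCS (h.A_subset n)).symm
    rw [h.nbrCount_S_eq_of_mem hG (h.mem_ballClasses_succ hG hSt (h.C_mem n) hCS) hz
      (h.S_subset n (h.B_subset _ hw))]
    exact h.swap.nbrCount_S_eq hG hSt
      (fun hBA => h.not_canAdj_A_B_succ hG hSt hacyc hAS hAC hBA.symm) hw
  · have hBS : B (n + 1) ≠ S (n + 1) := hAS ▸ (h.A_ne_B (n + 1)).symm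
    rw [h.nbrCount_S_eq_of_mem hG (h.A_mem (n + 1)) hx (hAS ▸ h.A_subset _ hw)]
    exact h.nbrCount_S_eq hG hSt
      (fun hAB => h.swap.not_canAdj_A_B_succ hG hSt hacyc hBS hBC hAB.symm) hw

end SymmLabels

end Labels

/-- Lemma 3.2: the vanishing/transfer identities for the indices of an
acyclic Sturmian coloring, together with the analogous identities with the roles of
`A` and `B` exchanged. -/
theorem acyclic_index_identities {V α : Type} (G : SimpleGraph V) (d : ℕ) (hd : 3 ≤ d)
    (hT : IsRegularTree G d) (φ : V → α) (hSt : IsSturmian G φ)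
    (a b : α) (hab : a ≠ b) (L : Labeling G φ a b)
    (hacyc : ∀ n, ¬ HasCycle G φ n) :
    AcyclicIndexIdentities G φ L.S L.C L.A L.B ∧
    AcyclicIndexIdentities G φ L.S L.C L.B L.A := by
  have hG := hT.isTree.connected
  have h := L.symmLabels hG hab
  exact ⟨h.acyclicIndexIdentities hG hSt hacyc, h.swap.acyclicIndexIdentities hG hSt hacyc⟩

end Sturm
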